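/- Let Ω ⊂ ℝⁿ be a bounded domain such that (Ω, k_Ω) is Gromov hyperbolic. Then the following are equivalent: (1) Ω is a QH-visibility domain; (2) the identity map id : (Ω, k_Ω) → (Ω, d_Euc) extends to a continuous surjective map Φ from the Gromov closure Ω̄^G onto the Euclidean closure Ω̄^Euc. -/

import Mathlib

open Metric Set Filter Topology MeasureTheory
open scoped NNReal ENNReal

noncomputable section

variable {E : Type*} [NormedAddCommGroup E] [NormedSpace ℝ E]

/-- The quasihyperbolic length of a path `γ : [a, b] → Ω`, i.e. `∫ ‖γ'(t)‖ / δ_Ω(γ t) dt`. -/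
def qhLength (Ω : Set E) (γ : ℝ → E) (a b : ℝ) : ℝ :=
  ∫ t in a..b, ‖deriv γ t‖ / infDist (γ t) Ωᶜ

/-- Admissible (Lipschitz, i.e. rectifiable) paths joining `x` to `y` inside `Ω`. -/
def qhAdmissible (Ω : Set E) (x y : E) (γ : ℝ → E) (a b : ℝ) : Prop :=
  a ≤ b ∧ γ a = x ∧ γ b = y ∧ (∀ t ∈ Icc a b, γ t ∈ Ω) ∧
    ∃ K : ℝ≥0, LipschitzOnWith K γ (Icc a b)

/-- The quasihyperbolic distance `k_Ω` on a domain `Ω`. -/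
def qhDist (Ω : Set E) (x y : E) : ℝ :=
  sInf { L : ℝ | ∃ γ a b, qhAdmissible Ω x y γ a b ∧ L = qhLength Ω γ a b }

/-- `γ` is a (unit-speed) quasihyperbolic geodesic on the parameter set `s`. -/
def IsQHGeodesicOn (Ω : Set E) (γ : ℝ → E) (s : Set ℝ) : Prop :=
  (∀ t ∈ s, γ t ∈ Ω) ∧ ∀ a ∈ s, ∀ b ∈ s, qhDist Ω (γ a) (γ b) = |a - b|

/-- `Ω` is a QH-visibility domain: any two distinct Euclidean boundary points have
neighbourhoods with disjoint closures together with a compact subset of `Ω` which is met by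
every quasihyperbolic geodesic joining the two neighbourhoods. -/
def QHVisibilityDomain (Ω : Set E) : Prop :=
  ∀ p ∈ frontier Ω, ∀ q ∈ frontier Ω, p ≠ q →
    ∃ U V : Set E, IsOpen U ∧ IsOpen V ∧ p ∈ U ∧ q ∈ V ∧
      closure U ∩ closure V = ∅ ∧
      ∃ K : Set E, IsCompact K ∧ K ⊆ Ω ∧
        ∀ (γ : ℝ → E) (T : ℝ), 0 ≤ T → IsQHGeodesicOn Ω γ (Icc 0 T) →
          γ 0 ∈ U → γ T ∈ V → ∃ t ∈ Icc 0 T, γ t ∈ K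

/-- The Gromov product with respect to the quasihyperbolic distance. -/
def qhGromovProd (Ω : Set E) (o x y : E) : ℝ :=
  (qhDist Ω x o + qhDist Ω o y - qhDist Ω x y) / 2

/-- `(Ω, k_Ω)` is Gromov hyperbolic (four-point condition on the Gromov product). -/
def QHGromovHyperbolic (Ω : Set E) : Prop :=
  ∃ δ : ℝ, 0 ≤ δ ∧ ∀ o ∈ Ω, ∀ x ∈ Ω, ∀ y ∈ Ω, ∀ z ∈ Ω,
    min (qhGromovProd Ω o x y) (qhGromovProd Ω o y z) - δ ≤ qhGromovProd Ω o x z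

section GromovClosure

variable {X : Type*} [TopologicalSpace X] (d : X → X → ℝ) (o : X)

/-- The Gromov product of the distance function `d` with base point `o`. -/
def gromovProdFun (x y : X) : ℝ := (d x o + d o y - d x y) / 2

/-- A Gromov sequence: the pairwise Gromov products tend to infinity. -/
def IsGromovSeq (u : ℕ → X) : Prop :=
  ∀ M : ℝ, ∃ N : ℕ, ∀ m ≥ N, ∀ n ≥ N, M ≤ gromovProdFun d o (u m) (u n)

/-- Equivalence of Gromov sequences. -/
def GromovSeqRel (u v : {u : ℕ → X // IsGromovSeq d o u}) : Prop :=
  Tendsto (fun k => gromovProdFun d o (u.1 k) (v.1 k)) atTop atTop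

/-- The Gromov boundary: equivalence classes of Gromov sequences. -/
def GromovBdry := Quot (GromovSeqRel d o)

/-- The Gromov closure: the space together with its Gromov boundary. -/
def GromovCl := X ⊕ GromovBdry d o

/-- Inclusion of the space into the Gromov closure. -/
def GromovCl.pt (x : X) : GromovCl d o := Sum.inl x

/-- Inclusion of the Gromov boundary into the Gromov closure. -/
def GromovCl.bd (ξ : GromovBdry d o) : GromovCl d o := Sum.inr ξ

/-- The sequences approximating a given point of the Gromov closure. -/
def gromovApproxSeqs : GromovCl d o → Set (ℕ → X) :=
  Sum.elim (fun x => ({fun _ => x} : Set (ℕ → X)))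
    (fun ξ => {u | ∃ h : IsGromovSeq d o u, Quot.mk (GromovSeqRel d o) ⟨u, h⟩ = ξ})

/-- The Gromov product extended to the Gromov closure. -/
def extGromovProd (a b : GromovCl d o) : EReal :=
  sInf { r : EReal | ∃ u ∈ gromovApproxSeqs d o a, ∃ v ∈ gromovApproxSeqs d o b,
    r = Filter.liminf (fun k => ((gromovProdFun d o (u k) (v k) : ℝ) : EReal)) atTop }

/-- The natural topology of the Gromov closure: generated by the open subsets of the space
together with the standard basic neighbourhoods of boundary points defined through the
extended Gromov product. -/
def gromovClTopology : TopologicalSpace (GromovCl d o) :=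
  TopologicalSpace.generateFrom
    ({ S | ∃ U : Set X, IsOpen U ∧ S = GromovCl.pt d o '' U } ∪
     { S | ∃ (ξ : GromovBdry d o) (R : ℝ),
        S = { a | (R : EReal) < extGromovProd d o a (GromovCl.bd d o ξ) } })

end GromovClosure

/-- The quasihyperbolic distance on the subtype `Ω`. -/
def qhSubDist (Ω : Set E) : ↥Ω → ↥Ω → ℝ := fun x y => qhDist Ω ↑x ↑y

/-- The Gromov boundary of `(Ω, k_Ω)`. -/
def QHGromovBoundary (Ω : Set E) (o : ↥Ω) := GromovBdry (qhSubDist Ω) o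

/-- The Gromov closure of `(Ω, k_Ω)`. -/
def QHGromovClosure (Ω : Set E) (o : ↥Ω) := GromovCl (qhSubDist Ω) o

instance (Ω : Set E) (o : ↥Ω) : TopologicalSpace (QHGromovClosure Ω o) :=
  gromovClTopology (qhSubDist Ω) o

/-- Inclusion of `Ω` into its Gromov closure. -/
def qhClPt (Ω : Set E) (o : ↥Ω) (x : ↥Ω) : QHGromovClosure Ω o :=
  GromovCl.pt (qhSubDist Ω) o x
section QuasihyperbolicMetric

set_option linter.unusedSectionVars false

variable {Ω : Set E}

theorem infDist_compl_pos (hΩ : IsOpen Ω) (hc : Ωᶜ.Nonempty) {x : E} (hx : x ∈ Ω) :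
    0 < infDist x Ωᶜ :=
  (hΩ.isClosed_compl.notMem_iff_infDist_pos hc).1 (by simpa using hx)

theorem qhLength_nonneg (γ : ℝ → E) {a b : ℝ} (hab : a ≤ b) : 0 ≤ qhLength Ω γ a b :=
  intervalIntegral.integral_nonneg hab fun _ _ => div_nonneg (norm_nonneg _) infDist_nonneg

theorem ae_mem_Ioo_of_mem_Ioc (a b : ℝ) : ∀ᵐ t : ℝ, t ∈ Ioc a b → t ∈ Ioo a b := by
  have : ∀ᵐ t : ℝ, t ≠ b := by simp [ae_iff, measure_singleton]
  filter_upwards [this] with t ht h using ⟨h.1, lt_of_le_of_ne h.2 ht⟩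

theorem norm_deriv_le_of_mem_Ioo {γ : ℝ → E} {a b : ℝ} {K : ℝ≥0}
    (hγ : LipschitzOnWith K γ (Icc a b)) {t : ℝ} (ht : t ∈ Ioo a b) : ‖deriv γ t‖ ≤ K :=
  norm_deriv_le_of_lipschitzOn (Icc_mem_nhds ht.1 ht.2) hγ

theorem exists_pos_le_infDist (hΩ : IsOpen Ω) (hc : Ωᶜ.Nonempty) {γ : ℝ → E} {a b : ℝ}
    (hγ : ContinuousOn γ (Icc a b)) (hmem : ∀ t ∈ Icc a b, γ t ∈ Ω) :
    ∃ m > 0, ∀ t ∈ Icc a b, m ≤ infDist (γ t) Ωᶜ := by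
  rcases (Icc a b).eq_empty_or_nonempty with h | h
  · exact ⟨1, one_pos, by simp [h]⟩
  obtain ⟨t, ht, hmin⟩ := isCompact_Icc.exists_isMinOn h
    ((continuous_infDist_pt Ωᶜ).comp_continuousOn hγ)
  exact ⟨_, infDist_compl_pos hΩ hc (hmem t ht), fun s hs => hmin hs⟩

theorem qhLength_integrableOn [CompleteSpace E] (hΩ : IsOpen Ω) (hc : Ωᶜ.Nonempty)
    {γ : ℝ → E} {a b : ℝ} {K : ℝ≥0} (hγ : LipschitzOnWith K γ (Icc a b))
    (hmem : ∀ t ∈ Icc a b, γ t ∈ Ω) :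
    IntegrableOn (fun t => ‖deriv γ t‖ / infDist (γ t) Ωᶜ) (Icc a b) := by
  obtain ⟨m, hm, hle⟩ := exists_pos_le_infDist hΩ hc hγ.continuousOn hmem
  rw [integrableOn_Icc_iff_integrableOn_Ioo]
  refine IntegrableOn.of_bound (by simp) ?_ (K / m) ?_
  · have h1 : AEMeasurable (fun t => ‖deriv γ t‖) (volume.restrict (Ioo a b)) :=
      (stronglyMeasurable_deriv γ).norm.measurable.aemeasurable
    have h2 : AEMeasurable (fun t => infDist (γ t) Ωᶜ) (volume.restrict (Ioo a b)) :=
      (((continuous_infDist_pt Ωᶜ).comp_continuousOn hγ.continuousOn).mono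
        Ioo_subset_Icc_self).aemeasurable measurableSet_Ioo
    exact (h1.div h2).aestronglyMeasurable
  · refine (ae_restrict_iff' measurableSet_Ioo).2 (ae_of_all _ fun t ht => ?_)
    rw [Real.norm_of_nonneg (div_nonneg (norm_nonneg _) infDist_nonneg)]
    exact div_le_div₀ K.2 (norm_deriv_le_of_mem_Ioo hγ ht) hm (hle t (Ioo_subset_Icc_self ht))

theorem qhAdmissible.intervalIntegrable [CompleteSpace E] (hΩ : IsOpen Ω) (hc : Ωᶜ.Nonempty)
    {x y : E} {γ : ℝ → E} {a b s t : ℝ} (h : qhAdmissible Ω x y γ a b)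
    (hs : s ∈ Icc a b) (ht : t ∈ Icc a b) :
    IntervalIntegrable (fun t => ‖deriv γ t‖ / infDist (γ t) Ωᶜ) volume s t := by
  obtain ⟨hab, -, -, hmem, K, hK⟩ := h
  have := (qhLength_integrableOn hΩ hc hK hmem)
  rw [← uIcc_of_le hab] at this hs ht
  exact (this.mono_set (uIcc_subset_uIcc hs ht)).intervalIntegrable

theorem qhLength_add [CompleteSpace E] (hΩ : IsOpen Ω) (hc : Ωᶜ.Nonempty)
    {x y : E} {γ : ℝ → E} {a b r s t : ℝ} (h : qhAdmissible Ω x y γ a b)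
    (hr : r ∈ Icc a b) (hs : s ∈ Icc a b) (ht : t ∈ Icc a b) :
    qhLength Ω γ r s + qhLength Ω γ s t = qhLength Ω γ r t :=
  intervalIntegral.integral_add_adjacent_intervals (h.intervalIntegrable hΩ hc hr hs)
    (h.intervalIntegrable hΩ hc hs ht)

theorem qhAdmissible.subpath {x y : E} {γ : ℝ → E} {a b s t : ℝ} (h : qhAdmissible Ω x y γ a b)
    (hs : s ∈ Icc a b) (ht : t ∈ Icc a b) (hst : s ≤ t) :
    qhAdmissible Ω (γ s) (γ t) γ s t := by
  obtain ⟨-, -, -, hmem, K, hK⟩ := h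
  have hsub : Icc s t ⊆ Icc a b := Icc_subset_Icc hs.1 ht.2
  exact ⟨hst, rfl, rfl, fun r hr => hmem r (hsub hr), K, hK.mono hsub⟩

theorem qhAdmissible.reverse {x y : E} {γ : ℝ → E} {a b : ℝ} (h : qhAdmissible Ω x y γ a b) :
    qhAdmissible Ω y x (fun t => γ (-t)) (-b) (-a) := by
  obtain ⟨hab, hx, hy, hmem, K, hK⟩ := h
  have hneg : ∀ t ∈ Icc (-b) (-a), -t ∈ Icc a b := fun t ht =>
    ⟨by linarith [ht.2], by linarith [ht.1]⟩
  refine ⟨neg_le_neg hab, by simpa, by simpa, fun t ht => hmem _ (hneg t ht), K, ?_⟩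
  refine LipschitzOnWith.of_dist_le_mul fun s hs t ht => ?_
  simpa only [dist_neg_neg] using hK.dist_le_mul _ (hneg s hs) _ (hneg t ht)

theorem qhLength_reverse (γ : ℝ → E) (a b : ℝ) :
    qhLength Ω (fun t => γ (-t)) (-b) (-a) = qhLength Ω γ a b := by
  have := intervalIntegral.integral_comp_neg (a := -b) (b := -a)
    (fun t => ‖deriv γ t‖ / infDist (γ t) Ωᶜ)
  simpa [qhLength, deriv_comp_neg] using this

theorem qhAdmissible.concat [CompleteSpace E] (hΩ : IsOpen Ω) (hc : Ωᶜ.Nonempty)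
    {x y z : E} {γ η : ℝ → E} {a b c d : ℝ}
    (h : qhAdmissible Ω x y γ a b) (h' : qhAdmissible Ω y z η c d) :
    ∃ (σ : ℝ → E) (e : ℝ), qhAdmissible Ω x z σ a e ∧
      qhLength Ω σ a e = qhLength Ω γ a b + qhLength Ω η c d := by
  obtain ⟨hab, hx, hy, hmem, K, hK⟩ := h
  obtain ⟨hcd, hy', hz, hmem', K', hK'⟩ := h'
  set σ : ℝ → E := fun t => if t ≤ b then γ t else η (t - (b - c)) with hσ
  have hσ₁ : ∀ t ≤ b, σ t = γ t := fun t ht => if_pos ht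
  have hσ₂ : ∀ t, b ≤ t → σ t = η (t - (b - c)) := by
    intro t ht
    rcases ht.eq_or_lt with rfl | ht
    · simp [hσ, hy, hy']
    · exact if_neg ht.not_ge
  have hsh : ∀ t, b ≤ t → t ≤ b + (d - c) → t - (b - c) ∈ Icc c d := fun t h₁ h₂ =>
    ⟨by linarith, by linarith⟩
  have hσadm : qhAdmissible Ω x z σ a (b + (d - c)) := by
    refine ⟨by linarith, by rw [hσ₁ a hab, hx], ?_, fun t ht => ?_, max K K', ?_⟩
    · rw [hσ₂ _ (by linarith), ← hz]
      congr 1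
      ring
    · rcases le_total t b with htb | htb
      · rw [hσ₁ t htb]
        exact hmem t ⟨ht.1, htb⟩
      · rw [hσ₂ t htb]
        exact hmem' _ (hsh t htb ht.2)
    · have key₁ : ∀ s t, a ≤ s → s ≤ t → t ≤ b → dist (σ s) (σ t) ≤ max K K' * (t - s) := by
        intro s t h₁ h₂ h₃
        rw [hσ₁ s (h₂.trans h₃), hσ₁ t h₃]
        refine (hK.dist_le_mul s ⟨h₁, h₂.trans h₃⟩ t ⟨h₁.trans h₂, h₃⟩).trans ?_
        rw [dist_comm, Real.dist_eq, abs_of_nonneg (sub_nonneg.2 h₂)]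
        exact mul_le_mul_of_nonneg_right (mod_cast le_max_left K K') (sub_nonneg.2 h₂)
      have key₂ : ∀ s t, b ≤ s → s ≤ t → t ≤ b + (d - c) →
          dist (σ s) (σ t) ≤ max K K' * (t - s) := by
        intro s t h₁ h₂ h₃
        rw [hσ₂ s h₁, hσ₂ t (h₁.trans h₂)]
        refine (hK'.dist_le_mul _ (hsh s h₁ (h₂.trans h₃)) _ (hsh t (h₁.trans h₂) h₃)).trans ?_
        rw [dist_sub_right, dist_comm, Real.dist_eq, abs_of_nonneg (sub_nonneg.2 h₂)]
        exact mul_le_mul_of_nonneg_right (mod_cast le_max_right K K') (sub_nonneg.2 h₂)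
      have key : ∀ s t, a ≤ s → s ≤ t → t ≤ b + (d - c) →
          dist (σ s) (σ t) ≤ max K K' * (t - s) := by
        intro s t h₁ h₂ h₃
        rcases le_total t b with htb | htb
        · exact key₁ s t h₁ h₂ htb
        rcases le_total b s with hsb | hsb
        · exact key₂ s t hsb h₂ h₃
        have := dist_triangle (σ s) (σ b) (σ t)
        linarith [key₁ s b h₁ hsb le_rfl, key₂ b t le_rfl htb h₃]
      refine LipschitzOnWith.of_dist_le_mul fun s hs t ht => ?_
      rw [Real.dist_eq]
      push_cast
      rcases le_total s t with hst | hst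
      · rw [abs_sub_comm, abs_of_nonneg (sub_nonneg.2 hst)]
        exact_mod_cast key s t hs.1 hst ht.2
      · rw [abs_of_nonneg (sub_nonneg.2 hst), dist_comm]
        exact_mod_cast key t s ht.1 hst hs.2
  refine ⟨σ, _, hσadm, ?_⟩
  rw [← qhLength_add hΩ hc hσadm (s := b) (left_mem_Icc.2 hσadm.1) ⟨hab, by linarith⟩
    (right_mem_Icc.2 hσadm.1)]
  congr 1
  · refine intervalIntegral.integral_congr_ae ?_
    filter_upwards [ae_mem_Ioo_of_mem_Ioc a b] with t ht h
    have ht := ht (by rwa [uIoc_of_le hab] at h)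
    have : σ =ᶠ[𝓝 t] γ := by
      filter_upwards [Iio_mem_nhds ht.2] with s hs using hσ₁ s (le_of_lt hs)
    rw [this.deriv_eq, this.eq_of_nhds]
  · have hsub := intervalIntegral.integral_comp_sub_right (a := b) (b := b + (d - c))
      (fun t => ‖deriv η t‖ / infDist (η t) Ωᶜ) (b - c)
    have e₁ : b - (b - c) = c := by ring
    have e₂ : b + (d - c) - (b - c) = d := by ring
    rw [e₁, e₂] at hsub
    rw [qhLength, qhLength, ← hsub]
    refine intervalIntegral.integral_congr_ae (ae_of_all _ fun t ht => ?_)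
    rw [uIoc_of_le (by linarith)] at ht
    have : σ =ᶠ[𝓝 t] fun t => η (t - (b - c)) := by
      filter_upwards [Ioi_mem_nhds ht.1] with s hs using hσ₂ s (le_of_lt hs)
    rw [this.deriv_eq, this.eq_of_nhds, deriv_comp_sub_const]

theorem qhDist_bddBelow (Ω : Set E) (x y : E) :
    BddBelow {L : ℝ | ∃ γ a b, qhAdmissible Ω x y γ a b ∧ L = qhLength Ω γ a b} := by
  refine ⟨0, ?_⟩
  rintro _ ⟨γ, a, b, h, rfl⟩
  exact qhLength_nonneg γ h.1

theorem qhDist_le {x y : E} {γ : ℝ → E} {a b : ℝ} (h : qhAdmissible Ω x y γ a b) :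
    qhDist Ω x y ≤ qhLength Ω γ a b :=
  csInf_le (qhDist_bddBelow Ω x y) ⟨γ, a, b, h, rfl⟩

theorem qhDist_nonneg (x y : E) : 0 ≤ qhDist Ω x y := by
  refine Real.sInf_nonneg ?_
  rintro _ ⟨γ, a, b, h, rfl⟩
  exact qhLength_nonneg γ h.1

theorem qhDist_comm (x y : E) : qhDist Ω x y = qhDist Ω y x := by
  unfold qhDist
  congr 1
  ext L
  constructor <;>
  · rintro ⟨γ, a, b, h, rfl⟩
    exact ⟨_, _, _, h.reverse, (qhLength_reverse γ a b).symm⟩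

theorem qhDist_self {x : E} (hx : x ∈ Ω) : qhDist Ω x x = 0 := by
  refine le_antisymm ?_ (qhDist_nonneg x x)
  have h : qhAdmissible Ω x x (fun _ => x) 0 0 :=
    ⟨le_rfl, rfl, rfl, fun _ _ => hx, 0, LipschitzOnWith.of_dist_le_mul (by simp)⟩
  simpa [qhLength] using qhDist_le h

/-- The straight segment between two points of a ball of radius `r` that stays at distance `r`
from the complement of `Ω`. -/
theorem exists_qhAdmissible_of_ball_subset (hc : Ωᶜ.Nonempty) {z x y : E} {r : ℝ} (hr : 0 < r)
    (hball : ball z (2 * r) ⊆ Ω) (hx : x ∈ ball z r) (hy : y ∈ ball z r) :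
    ∃ γ : ℝ → E, qhAdmissible Ω x y γ 0 1 ∧ qhLength Ω γ 0 1 ≤ ‖y - x‖ / r := by
  set γ : ℝ → E := fun t => x + t • (y - x) with hγ
  have hγball : ∀ t ∈ Icc (0 : ℝ) 1, γ t ∈ ball z r := fun t ht =>
    (convex_ball z r).add_smul_sub_mem hx hy ht
  have hderiv : ∀ t, deriv γ t = y - x := fun t => by
    have : HasDerivAt γ ((1 : ℝ) • (y - x)) t :=
      ((hasDerivAt_id t).smul_const (y - x)).const_add x
    simpa using this.deriv
  have hdist : ∀ t ∈ Icc (0 : ℝ) 1, r ≤ infDist (γ t) Ωᶜ := fun t ht => by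
    refine (le_infDist hc).2 fun w hw => not_lt.1 fun hlt => hw (hball ?_)
    have h₁ := mem_ball.1 (hγball t ht)
    have h₂ := dist_triangle w (γ t) z
    rw [dist_comm w (γ t)] at h₂
    exact mem_ball.2 (by linarith)
  refine ⟨γ, ⟨zero_le_one, by simp [hγ], by simp [hγ], fun t ht =>
    hball (ball_subset_ball (by linarith) (hγball t ht)), ‖y - x‖₊, ?_⟩, ?_⟩
  · refine LipschitzOnWith.of_dist_le_mul fun s _ t _ => ?_
    rw [hγ, dist_add_left, dist_eq_norm, ← sub_smul, norm_smul, coe_nnnorm, mul_comm,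
      Real.dist_eq, Real.norm_eq_abs]
  · have h := intervalIntegral.norm_integral_le_of_norm_le_const (a := (0 : ℝ)) (b := 1)
      (f := fun t => ‖deriv γ t‖ / infDist (γ t) Ωᶜ) (C := ‖y - x‖ / r) fun t ht => by
        rw [uIoc_of_le zero_le_one] at ht
        rw [Real.norm_of_nonneg (div_nonneg (norm_nonneg _) infDist_nonneg), hderiv]
        exact div_le_div_of_nonneg_left (norm_nonneg _) hr (hdist t (Ioc_subset_Icc_self ht))
    simpa [qhLength] using (le_abs_self _).trans h

theorem exists_ball_two_mul_subset (hΩ : IsOpen Ω) {z : E} (hz : z ∈ Ω) :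
    ∃ r > 0, ball z (2 * r) ⊆ Ω := by
  obtain ⟨ε, hε, h⟩ := Metric.isOpen_iff.1 hΩ z hz
  exact ⟨ε / 2, half_pos hε, by rwa [mul_div_cancel₀ ε two_ne_zero]⟩

theorem exists_qhAdmissible [CompleteSpace E] (hΩ : IsOpen Ω) (hconn : IsPreconnected Ω)
    (hc : Ωᶜ.Nonempty) {x y : E} (hx : x ∈ Ω) (hy : y ∈ Ω) :
    ∃ γ a b, qhAdmissible Ω x y γ a b := by
  refine hconn.induction₂ (fun x y => ∃ γ a b, qhAdmissible Ω x y γ a b)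
    (fun z hz => ?_) (fun x y z _ _ _ => ?_) (fun x y _ _ => ?_) hx hy
  · obtain ⟨r, hr, hball⟩ := exists_ball_two_mul_subset hΩ hz
    filter_upwards [mem_nhdsWithin_of_mem_nhds (ball_mem_nhds z hr)] with y hy
    obtain ⟨γ, hγ, -⟩ := exists_qhAdmissible_of_ball_subset hc hr hball (mem_ball_self hr) hy
    exact ⟨γ, 0, 1, hγ⟩
  · rintro ⟨γ, a, b, h⟩ ⟨η, c, d, h'⟩
    obtain ⟨σ, e, hσ, -⟩ := h.concat hΩ hc h'
    exact ⟨σ, a, e, hσ⟩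
  · rintro ⟨γ, a, b, h⟩
    exact ⟨_, _, _, h.reverse⟩

theorem exists_qhLength_lt [CompleteSpace E] (hΩ : IsOpen Ω) (hconn : IsPreconnected Ω)
    (hc : Ωᶜ.Nonempty) {x y : E} (hx : x ∈ Ω) (hy : y ∈ Ω) {ε : ℝ} (hε : 0 < ε) :
    ∃ γ a b, qhAdmissible Ω x y γ a b ∧ qhLength Ω γ a b < qhDist Ω x y + ε := by
  obtain ⟨γ, a, b, h⟩ := exists_qhAdmissible hΩ hconn hc hx hy
  obtain ⟨_, ⟨σ, c, d, hσ, rfl⟩, hlt⟩ := exists_lt_of_csInf_lt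
    (s := {L : ℝ | ∃ γ a b, qhAdmissible Ω x y γ a b ∧ L = qhLength Ω γ a b})
    ⟨_, γ, a, b, h, rfl⟩ (lt_add_of_pos_right (qhDist Ω x y) hε)
  exact ⟨σ, c, d, hσ, hlt⟩

theorem qhDist_triangle [CompleteSpace E] (hΩ : IsOpen Ω) (hconn : IsPreconnected Ω)
    (hc : Ωᶜ.Nonempty) {x y z : E} (hx : x ∈ Ω) (hy : y ∈ Ω) (hz : z ∈ Ω) :
    qhDist Ω x z ≤ qhDist Ω x y + qhDist Ω y z := by
  refine le_of_forall_pos_le_add fun ε hε => ?_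
  obtain ⟨γ, a, b, h, hl⟩ := exists_qhLength_lt hΩ hconn hc hx hy (half_pos hε)
  obtain ⟨η, c, d, h', hl'⟩ := exists_qhLength_lt hΩ hconn hc hy hz (half_pos hε)
  obtain ⟨σ, e, hσ, hlen⟩ := h.concat hΩ hc h'
  linarith [qhDist_le hσ]

/-- A real function along an admissible path whose derivative is controlled by the
quasihyperbolic density changes by at most the quasihyperbolic length. -/
theorem abs_sub_le_mul_qhLength [CompleteSpace E] (hΩ : IsOpen Ω) (hc : Ωᶜ.Nonempty)
    {x y : E} {γ : ℝ → E} {a b : ℝ} (h : qhAdmissible Ω x y γ a b) {f : ℝ → ℝ} {C : ℝ} {K : ℝ≥0}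
    (hf : LipschitzOnWith K f (Icc a b))
    (hderiv : ∀ᵐ t, t ∈ Ioo a b → |deriv f t| ≤ C * (‖deriv γ t‖ / infDist (γ t) Ωᶜ)) :
    |f b - f a| ≤ C * qhLength Ω γ a b := by
  have hab := h.1
  rw [← uIcc_of_le hab] at hf
  rw [← hf.absolutelyContinuousOnInterval.integral_deriv_eq_sub, qhLength,
    ← intervalIntegral.integral_const_mul, ← Real.norm_eq_abs]
  refine intervalIntegral.norm_integral_le_of_norm_le hab ?_
    ((h.intervalIntegrable hΩ hc (left_mem_Icc.2 hab) (right_mem_Icc.2 hab)).const_mul C)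
  filter_upwards [hderiv, ae_mem_Ioo_of_mem_Ioc a b] with t ht hto h
  exact ht (hto h)

theorem abs_deriv_comp_le_norm_deriv {φ : E → ℝ} (hφ : LipschitzWith 1 φ) {γ : ℝ → E} {t : ℝ}
    (hγ : DifferentiableAt ℝ γ t) : |deriv (φ ∘ γ) t| ≤ ‖deriv γ t‖ := by
  by_cases hd : DifferentiableAt ℝ (φ ∘ γ) t
  · have h₁ := (hd.hasDerivAt.tendsto_slope).abs
    have h₂ := (hγ.hasDerivAt.tendsto_slope).norm
    refine le_of_tendsto_of_tendsto' h₁ h₂ fun s => ?_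
    rw [slope_def_module, slope_def_module, norm_smul, smul_eq_mul, abs_mul, Real.norm_eq_abs]
    refine mul_le_mul_of_nonneg_left ?_ (abs_nonneg _)
    simpa [Real.dist_eq, dist_eq_norm] using hφ.dist_le_mul (γ s) (γ t)
  · simp [deriv_zero_of_not_differentiableAt hd]

theorem qhAdmissible.ae_differentiableAt [FiniteDimensional ℝ E] {x y : E} {γ : ℝ → E} {a b : ℝ}
    (h : qhAdmissible Ω x y γ a b) : ∀ᵐ t, t ∈ Ioo a b → DifferentiableAt ℝ γ t := by
  obtain ⟨-, -, -, -, K, hK⟩ := h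
  filter_upwards [hK.ae_differentiableWithinAt_of_mem_real] with t ht h
  exact (ht (Ioo_subset_Icc_self h)).differentiableAt (Icc_mem_nhds h.1 h.2)

theorem dist_le_mul_qhLength [FiniteDimensional ℝ E] (hΩ : IsOpen Ω) (hc : Ωᶜ.Nonempty) {D : ℝ}
    (hD : ∀ z ∈ Ω, infDist z Ωᶜ ≤ D) {x y : E} {γ : ℝ → E} {a b : ℝ}
    (h : qhAdmissible Ω x y γ a b) : dist x y ≤ D * qhLength Ω γ a b := by
  have : CompleteSpace E := FiniteDimensional.complete ℝ E
  have hd := h.ae_differentiableAt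
  obtain ⟨-, rfl, rfl, hmem, K, hK⟩ := id h
  have hφ : LipschitzWith 1 (fun z : E => dist z (γ a)) := LipschitzWith.dist_left _
  have key := abs_sub_le_mul_qhLength hΩ hc h (f := (fun z : E => dist z (γ a)) ∘ γ) (C := D)
    (hφ.comp_lipschitzOnWith hK) (by
      filter_upwards [hd] with t ht hto
      have hpos := infDist_compl_pos hΩ hc (hmem t (Ioo_subset_Icc_self hto))
      refine (abs_deriv_comp_le_norm_deriv hφ (ht hto)).trans ?_
      rw [← mul_div_assoc, le_div_iff₀ hpos, mul_comm D]
      exact mul_le_mul_of_nonneg_left (hD _ (hmem t (Ioo_subset_Icc_self hto))) (norm_nonneg _))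
  simpa [dist_comm (γ b), abs_of_nonneg dist_nonneg] using key

theorem abs_log_infDist_sub_le_qhLength [FiniteDimensional ℝ E] (hΩ : IsOpen Ω)
    (hc : Ωᶜ.Nonempty) {x y : E} {γ : ℝ → E} {a b : ℝ} (h : qhAdmissible Ω x y γ a b) :
    |Real.log (infDist y Ωᶜ) - Real.log (infDist x Ωᶜ)| ≤ qhLength Ω γ a b := by
  have : CompleteSpace E := FiniteDimensional.complete ℝ E
  have hd := h.ae_differentiableAt
  obtain ⟨-, rfl, rfl, hmem, K, hK⟩ := id h
  have hφ : LipschitzWith 1 (fun z : E => infDist z Ωᶜ) := lipschitz_infDist_pt Ωᶜ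
  obtain ⟨m, hm, hle⟩ := exists_pos_le_infDist hΩ hc hK.continuousOn hmem
  have hlip := hφ.comp_lipschitzOnWith hK
  have hlog : LipschitzOnWith (Real.toNNReal m⁻¹) Real.log (Ici m) := by
    refine (convex_Ici m).lipschitzOnWith_of_nnnorm_deriv_le
      (fun u hu => Real.differentiableAt_log (hm.trans_le hu).ne') fun u hu => ?_
    rw [← NNReal.coe_le_coe, coe_nnnorm, Real.deriv_log, Real.norm_of_nonneg
      (inv_nonneg.2 (hm.le.trans hu)), Real.coe_toNNReal _ (inv_nonneg.2 hm.le)]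
    exact inv_anti₀ hm hu
  have key := abs_sub_le_mul_qhLength hΩ hc h (C := 1)
    (f := Real.log ∘ ((fun z : E => infDist z Ωᶜ) ∘ γ)) (hlog.comp hlip fun t ht => hle t ht) (by
      filter_upwards [hd, hlip.ae_differentiableWithinAt_of_mem_real] with t ht hdt hto
      have hpos := infDist_compl_pos hΩ hc (hmem t (Ioo_subset_Icc_self hto))
      have hdiff := (hdt (Ioo_subset_Icc_self hto)).differentiableAt (Icc_mem_nhds hto.1 hto.2)
      have : HasDerivAt (Real.log ∘ ((fun z : E => infDist z Ωᶜ) ∘ γ))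
          (deriv ((fun z : E => infDist z Ωᶜ) ∘ γ) t / infDist (γ t) Ωᶜ) t :=
        hdiff.hasDerivAt.log hpos.ne'
      rw [this.deriv, abs_div, abs_of_pos hpos, one_mul]
      exact div_le_div_of_nonneg_right (abs_deriv_comp_le_norm_deriv hφ (ht hto)) hpos.le)
  simpa using key

end QuasihyperbolicMetric

/-- A function `d` with the properties of a pseudometric. -/
structure IsPseudoDist {X : Type*} (d : X → X → ℝ) : Prop where
  self : ∀ x, d x x = 0
  comm : ∀ x y, d x y = d y x
  triangle : ∀ x y z, d x z ≤ d x y + d y z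

section Geodesics

variable {X : Type*} {d : X → X → ℝ}

theorem IsPseudoDist.nonneg (hd : IsPseudoDist d) (x y : X) : 0 ≤ d x y := by
  linarith [hd.triangle x y x, hd.self x, hd.comm x y]

theorem IsPseudoDist.continuous [TopologicalSpace X] (hd : IsPseudoDist d)
    (h : ∀ x, Tendsto (d x) (𝓝 x) (𝓝 0)) : Continuous fun p : X × X => d p.1 p.2 := by
  refine continuous_iff_continuousAt.2 fun p => ?_
  have h₀ : Tendsto (fun q : X × X => d p.1 q.1 + d p.2 q.2) (𝓝 p) (𝓝 0) := by
    simpa using ((h p.1).comp (continuous_fst.tendsto p)).add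
      ((h p.2).comp (continuous_snd.tendsto p))
  refine tendsto_iff_dist_tendsto_zero.2 (squeeze_zero (fun _ => dist_nonneg) (fun q => ?_) h₀)
  rw [Real.dist_eq, abs_le]
  constructor <;>
    linarith [hd.triangle p.1 q.1 p.2, hd.triangle q.1 q.2 p.2, hd.triangle q.1 p.1 q.2,
      hd.triangle p.1 p.2 q.2, hd.comm p.1 q.1, hd.comm p.2 q.2]

/-- `γ` is a geodesic for `d` from `x` to `y`, parametrized by arc length on `[0, d x y]`. -/
def IsGeodesicFromTo (d : X → X → ℝ) (x y : X) (γ : ℝ → X) : Prop :=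
  γ 0 = x ∧ γ (d x y) = y ∧
    ∀ s ∈ Icc 0 (d x y), ∀ t ∈ Icc 0 (d x y), d (γ s) (γ t) = |s - t|

theorem exists_isGeodesicFromTo [TopologicalSpace X] [T2Space X] (hd : IsPseudoDist d)
    (hcont : Continuous fun p : X × X => d p.1 p.2)
    (hprop : ∀ x R, IsCompact {z | d x z ≤ R}) (x y : X)
    (happrox : ∀ ε > 0, ∃ γ : ℝ → X, γ 0 = x ∧ γ (d x y) = y ∧
      ∀ s ∈ Icc 0 (d x y), ∀ t ∈ Icc 0 (d x y), abs (d (γ s) (γ t) - |s - t|) ≤ ε) :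
    ∃ γ, IsGeodesicFromTo d x y γ := by
  set L := d x y with hL
  have hL₀ : 0 ≤ L := hd.nonneg x y
  let S : ℕ → Set (ℝ → X) := fun n => (univ.pi fun _ => {z | d x z ≤ L + 1}) ∩
    {γ | γ 0 = x ∧ γ L = y ∧ ∀ s ∈ Icc 0 L, ∀ t ∈ Icc 0 L,
      abs (d (γ s) (γ t) - |s - t|) ≤ 1 / ((n : ℝ) + 1)}
  have hclosed : ∀ n : ℕ, IsClosed {γ : ℝ → X | γ 0 = x ∧ γ L = y ∧ ∀ s ∈ Icc 0 L, ∀ t ∈ Icc 0 L,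
      abs (d (γ s) (γ t) - |s - t|) ≤ 1 / ((n : ℝ) + 1)} := by
    intro n
    simp only [ofPred_and, ofPred_forall]
    refine (isClosed_eq (continuous_apply 0) continuous_const).inter
      ((isClosed_eq (continuous_apply L) continuous_const).inter ?_)
    refine isClosed_iInter fun s => isClosed_iInter fun _ => isClosed_iInter fun t =>
      isClosed_iInter fun _ => isClosed_le ?_ continuous_const
    have : Continuous fun γ : ℝ → X => d (γ s) (γ t) :=
      hcont.comp (f := fun γ : ℝ → X => (γ s, γ t))
        ((continuous_apply s).prodMk (continuous_apply t))
    exact (this.sub continuous_const).abs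
  have hcpt : IsCompact (univ.pi fun _ : ℝ => {z | d x z ≤ L + 1}) :=
    isCompact_univ_pi fun _ => hprop x (L + 1)
  have hne : (⋂ n, S n).Nonempty := by
    refine IsCompact.nonempty_iInter_of_sequence_nonempty_isCompact_isClosed S ?_ ?_
      (hcpt.inter_right (hclosed 0)) fun n => hcpt.isClosed.inter (hclosed n)
    · rintro n γ ⟨hK, h0, h1, h⟩
      refine ⟨hK, h0, h1, fun s hs t ht => (h s hs t ht).trans ?_⟩
      exact Nat.one_div_le_one_div (Nat.le_succ n)
    · intro n
      obtain ⟨γ, h0, h1, h⟩ := happrox (1 / ((n : ℝ) + 1)) Nat.one_div_pos_of_nat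
      have hproj : ∀ t ∈ Icc 0 L, max 0 (min L t) = t := fun t ht => by
        rw [min_eq_right ht.2, max_eq_right ht.1]
      refine ⟨fun t => γ (max 0 (min L t)), fun t _ => ?_, ?_, ?_, fun s hs t ht => ?_⟩
      · have hmem : max 0 (min L t) ∈ Icc 0 L :=
          ⟨le_max_left _ _, max_le hL₀ (min_le_left _ _)⟩
        have hle := abs_le.1 (h 0 (left_mem_Icc.2 hL₀) _ hmem)
        rw [h0, zero_sub, abs_neg, abs_of_nonneg hmem.1] at hle
        have : 1 / ((n : ℝ) + 1) ≤ 1 := by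
          rw [div_le_one (by positivity)]
          linarith [(Nat.cast_nonneg n : (0 : ℝ) ≤ n)]
        simp only [mem_ofPred_eq]
        linarith [hle.2, hmem.2]
      · simpa only [hproj 0 (left_mem_Icc.2 hL₀)] using h0
      · simpa only [hproj L (right_mem_Icc.2 hL₀)] using h1
      · simpa only [hproj s hs, hproj t ht] using h s hs t ht
  obtain ⟨γ, hγ⟩ := hne
  rw [mem_iInter] at hγ
  refine ⟨γ, (hγ 0).2.1, (hγ 0).2.2.1, fun s hs t ht => ?_⟩
  have hlim := tendsto_one_div_add_atTop_nhds_zero_nat (𝕜 := ℝ)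
  have := ge_of_tendsto' hlim fun n => (hγ n).2.2.2 s hs t ht
  exact sub_eq_zero.1 (abs_nonpos_iff.1 this)

end Geodesics

section QuasihyperbolicSpace

set_option linter.unusedSectionVars false

variable {Ω : Set E}

theorem qhSubDist_isPseudoDist [CompleteSpace E] (hΩ : IsOpen Ω) (hconn : IsPreconnected Ω)
    (hc : Ωᶜ.Nonempty) : IsPseudoDist (qhSubDist Ω) where
  self x := qhDist_self x.2
  comm x y := qhDist_comm x.1 y.1
  triangle x y z := qhDist_triangle hΩ hconn hc x.2 y.2 z.2

theorem continuous_qhSubDist [CompleteSpace E] (hΩ : IsOpen Ω) (hconn : IsPreconnected Ω)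
    (hc : Ωᶜ.Nonempty) : Continuous fun p : Ω × Ω => qhSubDist Ω p.1 p.2 := by
  refine (qhSubDist_isPseudoDist hΩ hconn hc).continuous fun x => ?_
  obtain ⟨r, hr, hball⟩ := exists_ball_two_mul_subset hΩ x.2
  have hlim : Tendsto (fun y : Ω => ‖(y : E) - x‖ / r) (𝓝 x) (𝓝 0) := by
    have : Continuous fun y : Ω => ‖(y : E) - x‖ / r := by fun_prop
    simpa using this.tendsto x
  refine squeeze_zero' (Eventually.of_forall fun y => qhDist_nonneg _ _) ?_ hlim
  filter_upwards [continuous_subtype_val.continuousAt (ball_mem_nhds (x : E) hr)] with y hy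
  obtain ⟨γ, hγ, hlen⟩ := exists_qhAdmissible_of_ball_subset hc hr hball (mem_ball_self hr) hy
  exact (qhDist_le hγ).trans hlen

theorem exists_infDist_le (hbdd : Bornology.IsBounded Ω) (hc : Ωᶜ.Nonempty) :
    ∃ D, ∀ z ∈ Ω, infDist z Ωᶜ ≤ D := by
  obtain ⟨w, hw⟩ := hc
  obtain ⟨D, hD⟩ := hbdd.subset_closedBall w
  exact ⟨D, fun z hz => (infDist_le_dist_of_mem hw).trans (hD hz)⟩

theorem eq_of_qhDist_eq_zero [FiniteDimensional ℝ E] (hΩ : IsOpen Ω) (hconn : IsPreconnected Ω)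
    (hbdd : Bornology.IsBounded Ω) (hc : Ωᶜ.Nonempty) {x y : E} (hx : x ∈ Ω) (hy : y ∈ Ω)
    (h : qhDist Ω x y = 0) : x = y := by
  have : CompleteSpace E := FiniteDimensional.complete ℝ E
  obtain ⟨D, hD⟩ := exists_infDist_le hbdd hc
  have hDpos : 0 < D := (infDist_compl_pos hΩ hc hx).trans_le (hD x hx)
  refine dist_le_zero.1 (le_of_forall_pos_le_add fun ε hε => ?_)
  obtain ⟨γ, a, b, hγ, hlen⟩ := exists_qhLength_lt hΩ hconn hc hx hy (div_pos hε hDpos)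
  rw [h, zero_add, lt_div_iff₀ hDpos, mul_comm] at hlen
  linarith [dist_le_mul_qhLength hΩ hc hD hγ]

theorem abs_log_infDist_sub_le_qhDist [FiniteDimensional ℝ E] (hΩ : IsOpen Ω)
    (hconn : IsPreconnected Ω) (hc : Ωᶜ.Nonempty) {x y : E} (hx : x ∈ Ω) (hy : y ∈ Ω) :
    |Real.log (infDist y Ωᶜ) - Real.log (infDist x Ωᶜ)| ≤ qhDist Ω x y := by
  have : CompleteSpace E := FiniteDimensional.complete ℝ E
  refine le_of_forall_pos_le_add fun ε hε => ?_
  obtain ⟨γ, a, b, hγ, hlen⟩ := exists_qhLength_lt hΩ hconn hc hx hy hε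
  exact (abs_log_infDist_sub_le_qhLength hΩ hc hγ).trans hlen.le

theorem isCompact_qhSubDist_le [FiniteDimensional ℝ E] (hΩ : IsOpen Ω)
    (hconn : IsPreconnected Ω) (hbdd : Bornology.IsBounded Ω) (hc : Ωᶜ.Nonempty) (x : Ω) (R : ℝ) :
    IsCompact {z : Ω | qhSubDist Ω x z ≤ R} := by
  have : CompleteSpace E := FiniteDimensional.complete ℝ E
  have : ProperSpace E := FiniteDimensional.proper ℝ E
  set m := infDist (x : E) Ωᶜ * Real.exp (-R) with hm
  have hx := infDist_compl_pos hΩ hc x.2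
  have hmpos : 0 < m := mul_pos hx (Real.exp_pos _)
  have hsub : {w : E | m ≤ infDist w Ωᶜ} ⊆ Ω := fun w hw => by
    by_contra hw'
    exact (hmpos.trans_le hw).ne' (infDist_zero_of_mem hw')
  have hcpt : IsCompact {w : E | m ≤ infDist w Ωᶜ} :=
    Metric.isCompact_of_isClosed_isBounded
      (isClosed_le continuous_const (continuous_infDist_pt Ωᶜ)) (hbdd.subset hsub)
  have hcpt' : IsCompact ((↑) ⁻¹' {w : E | m ≤ infDist w Ωᶜ} : Set Ω) := by
    rw [Subtype.isCompact_iff, Subtype.image_preimage_coe, inter_eq_right.2 hsub]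
    exact hcpt
  refine hcpt'.of_isClosed_subset (isClosed_le
    ((continuous_qhSubDist hΩ hconn hc).comp (Continuous.prodMk_right x)) continuous_const) ?_
  intro z hz
  have hzpos := infDist_compl_pos hΩ hc z.2
  have h := (abs_le.1 ((abs_log_infDist_sub_le_qhDist hΩ hconn hc x.2 z.2).trans hz)).1
  change m ≤ infDist (z : E) Ωᶜ
  rw [← Real.log_le_log_iff hmpos hzpos, hm, Real.log_mul hx.ne' (Real.exp_ne_zero _),
    Real.log_exp]
  linarith

theorem qhAdmissible.qhDist_le_abs_sub [CompleteSpace E] (hΩ : IsOpen Ω) (hc : Ωᶜ.Nonempty)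
    {x y : E} {γ : ℝ → E} {a b s t : ℝ} (h : qhAdmissible Ω x y γ a b)
    (hs : s ∈ Icc a b) (ht : t ∈ Icc a b) :
    qhDist Ω (γ s) (γ t) ≤ |qhLength Ω γ a s - qhLength Ω γ a t| := by
  have ha := left_mem_Icc.2 h.1
  rcases le_total s t with hst | hst
  · have hadd := qhLength_add hΩ hc h ha hs ht
    exact (qhDist_le (h.subpath hs ht hst)).trans (by
      rw [abs_sub_comm, ← hadd, add_sub_cancel_left]
      exact le_abs_self _)
  · have hadd := qhLength_add hΩ hc h ha ht hs
    rw [qhDist_comm]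
    exact (qhDist_le (h.subpath ht hs hst)).trans (by
      rw [← hadd, add_sub_cancel_left]
      exact le_abs_self _)

/-- Parametrizing an almost length-minimizing path proportionally to quasihyperbolic length
gives an almost isometric path. -/
theorem exists_almost_isometric_path [FiniteDimensional ℝ E] (hΩ : IsOpen Ω)
    (hconn : IsPreconnected Ω) (hbdd : Bornology.IsBounded Ω) (hc : Ωᶜ.Nonempty) (x y : Ω)
    {ε : ℝ} (hε : 0 < ε) :
    ∃ γ : ℝ → Ω, γ 0 = x ∧ γ (qhSubDist Ω x y) = y ∧
      ∀ s ∈ Icc 0 (qhSubDist Ω x y), ∀ t ∈ Icc 0 (qhSubDist Ω x y),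
        abs (qhSubDist Ω (γ s) (γ t) - |s - t|) ≤ ε := by
  have : CompleteSpace E := FiniteDimensional.complete ℝ E
  have hd := qhSubDist_isPseudoDist hΩ hconn hc
  rcases (hd.nonneg x y).eq_or_lt with hL | hL
  · have hxy : x = y := Subtype.ext (eq_of_qhDist_eq_zero hΩ hconn hbdd hc x.2 y.2 hL.symm)
    refine ⟨fun _ => x, rfl, hxy, fun s hs t ht => ?_⟩
    rw [← hL, Icc_self, mem_singleton_iff] at hs ht
    simpa [hs, ht, hd.self] using hε.le
  set L := qhSubDist Ω x y with hLdef
  obtain ⟨σ, a, b, hσ, hlen⟩ := exists_qhLength_lt hΩ hconn hc x.2 y.2 hε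
  change qhLength Ω σ a b < L + ε at hlen
  set ℓ : ℝ → ℝ := fun t => qhLength Ω σ a t with hℓ
  set M := qhLength Ω σ a b with hM
  have hLM : L ≤ M := qhDist_le hσ
  have hab := hσ.1
  have hℓcont : ContinuousOn ℓ (Icc a b) := by
    obtain ⟨-, -, -, hmem, K, hK⟩ := hσ
    have := intervalIntegral.continuousOn_primitive_interval (a := a) (b := b) (μ := volume)
      (f := fun t => ‖deriv σ t‖ / infDist (σ t) Ωᶜ)
      (by rw [uIcc_of_le hab]; exact qhLength_integrableOn hΩ hc hK hmem)
    rwa [uIcc_of_le hab] at this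
  have hℓa : ℓ a = 0 := intervalIntegral.integral_same
  have hparam : ∀ s, ∃ t ∈ Icc a b, (s ∈ Icc 0 L → ℓ t = s * (M / L)) ∧ (s = 0 → t = a) ∧
      (s = L → t = b) := by
    intro s
    by_cases h0 : s = 0
    · exact ⟨a, left_mem_Icc.2 hab, fun _ => by rw [hℓa, h0, zero_mul], fun _ => rfl,
        fun h => absurd (h0.symm.trans h) hL.ne⟩
    by_cases h1 : s = L
    · refine ⟨b, right_mem_Icc.2 hab, fun _ => ?_, fun h => absurd h h0, fun _ => rfl⟩
      rw [h1, mul_div_cancel₀ _ hL.ne']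
    by_cases hs : s ∈ Icc 0 L
    · have hM0 : 0 ≤ M := hL.le.trans hLM
      obtain ⟨t, ht, hts⟩ := intermediate_value_Icc hab hℓcont (show s * (M / L) ∈ _ from ⟨by
        rw [hℓa]; exact mul_nonneg hs.1 (div_nonneg hM0 hL.le), by
        rw [← mul_div_assoc, div_le_iff₀ hL, mul_comm]
        exact mul_le_mul_of_nonneg_left hs.2 hM0⟩)
      exact ⟨t, ht, fun _ => hts, fun h => absurd h h0, fun h => absurd h h1⟩
    · exact ⟨a, left_mem_Icc.2 hab, fun h => absurd h hs, fun h => absurd h h0,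
        fun h => absurd h h1⟩
  choose τ hτ hℓτ hτ0 hτL using hparam
  have key : ∀ s ∈ Icc 0 L, ∀ t ∈ Icc 0 L, s ≤ t →
      |qhDist Ω (σ (τ s)) (σ (τ t)) - (t - s)| ≤ ε := by
    intro s hs t ht hst
    have h₁ := hσ.qhDist_le_abs_sub hΩ hc (hτ s) (hτ t)
    have h₂ := qhDist_le (hσ.subpath (left_mem_Icc.2 hab) (hτ s) (hτ s).1)
    have h₃ := qhDist_le (hσ.subpath (hτ t) (right_mem_Icc.2 hab) (hτ t).2)
    have h₄ : ℓ (τ t) + qhLength Ω σ (τ t) b = M :=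
      qhLength_add hΩ hc hσ (left_mem_Icc.2 hab) (hτ t) (right_mem_Icc.2 hab)
    have hmem := hσ.2.2.2.1
    have htri₁ := qhDist_triangle hΩ hconn hc x.2 (hmem _ (hτ s)) y.2
    have htri₂ := qhDist_triangle hΩ hconn hc (hmem _ (hτ s)) (hmem _ (hτ t)) y.2
    rw [hσ.2.1] at h₂
    rw [hσ.2.2.1] at h₃
    have hℓs : ℓ (τ s) = s + s * ((M - L) / L) := by
      rw [hℓτ s hs]
      field_simp
      ring
    have hℓt : ℓ (τ t) = t + t * ((M - L) / L) := by
      rw [hℓτ t ht]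
      field_simp
      ring
    have hq : 0 ≤ (M - L) / L := div_nonneg (by linarith) hL.le
    have hqL : L * ((M - L) / L) = M - L := mul_div_cancel₀ _ hL.ne'
    have hmono : 0 ≤ (t - s) * ((M - L) / L) := mul_nonneg (by linarith) hq
    have hle : (t - s) * ((M - L) / L) ≤ M - L :=
      (mul_le_mul_of_nonneg_right (by linarith [hs.1, ht.2]) hq).trans_eq hqL
    change _ ≤ |ℓ (τ s) - ℓ (τ t)| at h₁
    change _ ≤ ℓ (τ s) at h₂
    change L ≤ _ at htri₁
    rw [abs_sub_comm, hℓs, hℓt, abs_of_nonneg (by linarith)] at h₁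
    rw [hℓs] at h₂
    rw [hℓt] at h₄
    rw [abs_le]
    constructor <;> linarith
  refine ⟨fun s => ⟨σ (τ s), hσ.2.2.2.1 _ (hτ s)⟩, Subtype.ext ?_, Subtype.ext ?_,
    fun s hs t ht => ?_⟩
  · simp only [hτ0 0 rfl, hσ.2.1]
  · simp only [hτL L rfl, hσ.2.2.1]
  · rcases le_total s t with hst | hst
    · rw [abs_sub_comm s, abs_of_nonneg (sub_nonneg.2 hst)]
      exact key s hs t ht hst
    · rw [abs_of_nonneg (sub_nonneg.2 hst), hd.comm]
      exact key t ht s hs hst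

theorem exists_qhGeodesic [FiniteDimensional ℝ E] (hΩ : IsOpen Ω)
    (hconn : IsPreconnected Ω) (hbdd : Bornology.IsBounded Ω) (hc : Ωᶜ.Nonempty) (x y : Ω) :
    ∃ γ, IsGeodesicFromTo (qhSubDist Ω) x y γ :=
  have : CompleteSpace E := FiniteDimensional.complete ℝ E
  exists_isGeodesicFromTo (qhSubDist_isPseudoDist hΩ hconn hc) (continuous_qhSubDist hΩ hconn hc)
    (isCompact_qhSubDist_le hΩ hconn hbdd hc) x y
    fun _ hε => exists_almost_isometric_path hΩ hconn hbdd hc x y hε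

end QuasihyperbolicSpace

section GromovCompactification

set_option linter.unusedSectionVars false

variable {X : Type*} [TopologicalSpace X] {d : X → X → ℝ} {o : X} {δ : ℝ}

/-- Gromov's four-point condition with base point `o` and constant `δ`. -/
def FourPointCondition (d : X → X → ℝ) (o : X) (δ : ℝ) : Prop :=
  ∀ x y z, min (gromovProdFun d o x y) (gromovProdFun d o y z) - δ ≤ gromovProdFun d o x z

theorem IsPseudoDist.gromovProdFun_comm (hd : IsPseudoDist d) (x y : X) :
    gromovProdFun d o x y = gromovProdFun d o y x := by
  simp only [gromovProdFun, hd.comm x y, hd.comm x o, hd.comm y o, add_comm]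

theorem IsPseudoDist.gromovProdFun_le_left (hd : IsPseudoDist d) (x y : X) :
    gromovProdFun d o x y ≤ d o x := by
  unfold gromovProdFun
  linarith [hd.triangle o x y, hd.comm x o]

theorem FourPointCondition.le (h : FourPointCondition d o δ) {x y z : X} {M : ℝ}
    (hxy : M ≤ gromovProdFun d o x y) (hyz : M ≤ gromovProdFun d o y z) :
    M - δ ≤ gromovProdFun d o x z :=
  (sub_le_sub_right (le_min hxy hyz) δ).trans (h x y z)

/-- A geodesic comes within `2 * δ` of realizing the Gromov product of its endpoints. -/
theorem FourPointCondition.exists_dist_le (h : FourPointCondition d o δ) (hd : IsPseudoDist d)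
    {x y : X} {γ : ℝ → X} (hγ : IsGeodesicFromTo d x y γ) :
    ∃ t ∈ Icc 0 (d x y), d o (γ t) ≤ gromovProdFun d o x y + 2 * δ := by
  obtain ⟨h0, h1, hiso⟩ := hγ
  have hL := hd.nonneg x y
  set t := (d x y + d x o - d y o) / 2 with ht
  have htmem : t ∈ Icc 0 (d x y) := by
    constructor
    · linarith [hd.triangle y x o, hd.comm x y]
    · linarith [hd.triangle x y o]
  have hx : d x (γ t) = t := by
    have := hiso 0 (left_mem_Icc.2 hL) t htmem
    rwa [h0, zero_sub, abs_neg, abs_of_nonneg htmem.1] at this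
  have hy : d (γ t) y = d x y - t := by
    have := hiso t htmem _ (right_mem_Icc.2 hL)
    rwa [h1, abs_sub_comm, abs_of_nonneg (sub_nonneg.2 htmem.2)] at this
  refine ⟨t, htmem, ?_⟩
  have key := h.le (M := (d o (γ t) + gromovProdFun d o x y) / 2) (x := x) (y := γ t) (z := y)
    (by unfold gromovProdFun; linarith [hd.comm o y])
    (by unfold gromovProdFun; linarith [hd.comm o y, hd.comm o (γ t)])
  linarith

theorem IsGromovSeq.of_tendsto (h : FourPointCondition d o δ) (hd : IsPseudoDist d) (hδ : 0 ≤ δ)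
    {u v : ℕ → X} (hu : IsGromovSeq d o u)
    (huv : Tendsto (fun k => gromovProdFun d o (u k) (v k)) atTop atTop) :
    IsGromovSeq d o v := by
  intro M
  obtain ⟨N, hN⟩ := hu (M + 2 * δ)
  obtain ⟨N', hN'⟩ := eventually_atTop.1 (huv.eventually_ge_atTop (M + 2 * δ))
  refine ⟨max N N', fun m hm n hn => ?_⟩
  have hm₁ := hN' m (le_of_max_le_right hm)
  rw [hd.gromovProdFun_comm] at hm₁
  have h₁ := h.le hm₁ (hN m (le_of_max_le_left hm) n (le_of_max_le_left hn))
  have h₂ := h.le h₁ (by linarith [hN' n (le_of_max_le_right hn)])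
  linarith

theorem gromovSeqRel_equivalence (h : FourPointCondition d o δ) (hd : IsPseudoDist d) :
    Equivalence (GromovSeqRel d o) where
  refl u := tendsto_atTop.2 fun M => by
    obtain ⟨N, hN⟩ := u.2 M
    filter_upwards [eventually_ge_atTop N] with k hk using hN k hk k hk
  symm {u v} huv := by
    simpa only [GromovSeqRel, hd.gromovProdFun_comm] using huv
  trans {u v w} huv hvw := tendsto_atTop.2 fun M => by
    filter_upwards [huv.eventually_ge_atTop (M + δ), hvw.eventually_ge_atTop (M + δ)] with k h₁ h₂
    linarith [h.le h₁ h₂]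

theorem exists_mem_gromovApproxSeqs (a : GromovCl d o) : ∃ u, u ∈ gromovApproxSeqs d o a := by
  rcases a with x | ξ
  · exact ⟨fun _ => x, rfl⟩
  · obtain ⟨⟨u, hu⟩, rfl⟩ := Quot.exists_rep ξ
    exact ⟨u, hu, rfl⟩

/-- Any two sequences representing the same boundary point have Gromov products tending to
infinity, with independent indices. -/
theorem tendsto_gromovProdFun_of_mem (h : FourPointCondition d o δ) (hd : IsPseudoDist d)
    {ξ : GromovBdry d o} {u v : ℕ → X} (hu : u ∈ gromovApproxSeqs d o (GromovCl.bd d o ξ))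
    (hv : v ∈ gromovApproxSeqs d o (GromovCl.bd d o ξ)) :
    Tendsto (fun p : ℕ × ℕ => gromovProdFun d o (u p.1) (v p.2)) atTop atTop := by
  obtain ⟨hu, rfl⟩ := hu
  obtain ⟨hv, huv⟩ := hv
  have hrel : GromovSeqRel d o ⟨u, hu⟩ ⟨v, hv⟩ :=
    (gromovSeqRel_equivalence h hd).eqvGen_iff.1 (Quot.eqvGen_exact huv.symm)
  refine tendsto_atTop.2 fun M => ?_
  obtain ⟨N, hN⟩ := hu (M + δ)
  obtain ⟨N', hN'⟩ := eventually_atTop.1 (hrel.eventually_ge_atTop (M + δ))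
  filter_upwards [eventually_ge_atTop (max N N', max N N')] with p hp
  have h₁ := hN p.1 (le_of_max_le_left hp.1) p.2 (le_of_max_le_left hp.2)
  have h₂ := hN' p.2 (le_of_max_le_right hp.2)
  linarith [h.le h₁ h₂]

theorem tendsto_gromovProdFun_comp (h : FourPointCondition d o δ) (hd : IsPseudoDist d)
    {ξ : GromovBdry d o} {u v : ℕ → X} (hu : u ∈ gromovApproxSeqs d o (GromovCl.bd d o ξ))
    (hv : v ∈ gromovApproxSeqs d o (GromovCl.bd d o ξ)) {φ ψ : ℕ → ℕ}
    (hφ : Tendsto φ atTop atTop) (hψ : Tendsto ψ atTop atTop) :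
    Tendsto (fun k => gromovProdFun d o (u (φ k)) (v (ψ k))) atTop atTop := by
  have := tendsto_gromovProdFun_of_mem h hd hu hv
  rw [← prod_atTop_atTop_eq] at this
  exact this.comp (hφ.prodMk hψ)

theorem mem_gromovApproxSeqs_of_tendsto (h : FourPointCondition d o δ) (hd : IsPseudoDist d)
    (hδ : 0 ≤ δ) {ξ : GromovBdry d o} {u v : ℕ → X}
    (hu : u ∈ gromovApproxSeqs d o (GromovCl.bd d o ξ))
    (huv : Tendsto (fun k => gromovProdFun d o (u k) (v k)) atTop atTop) :
    v ∈ gromovApproxSeqs d o (GromovCl.bd d o ξ) := by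
  obtain ⟨hu, rfl⟩ := hu
  have hrel : GromovSeqRel d o ⟨u, hu⟩ ⟨v, hu.of_tendsto h hd hδ huv⟩ := huv
  exact ⟨_, (Quot.sound hrel).symm⟩

theorem comp_mem_gromovApproxSeqs (h : FourPointCondition d o δ) (hd : IsPseudoDist d)
    (hδ : 0 ≤ δ) {ξ : GromovBdry d o} {u : ℕ → X}
    (hu : u ∈ gromovApproxSeqs d o (GromovCl.bd d o ξ)) {φ : ℕ → ℕ}
    (hφ : Tendsto φ atTop atTop) :
    (fun k => u (φ k)) ∈ gromovApproxSeqs d o (GromovCl.bd d o ξ) :=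
  mem_gromovApproxSeqs_of_tendsto h hd hδ hu (tendsto_gromovProdFun_comp h hd hu hu tendsto_id hφ)

theorem extGromovProd_le {a b : GromovCl d o} {u v : ℕ → X} (hu : u ∈ gromovApproxSeqs d o a)
    (hv : v ∈ gromovApproxSeqs d o b) : extGromovProd d o a b ≤
      Filter.liminf (fun k => ((gromovProdFun d o (u k) (v k) : ℝ) : EReal)) atTop :=
  sInf_le ⟨u, hu, v, hv, rfl⟩

theorem extGromovProd_bd_self (h : FourPointCondition d o δ) (hd : IsPseudoDist d)
    (ξ : GromovBdry d o) :
    extGromovProd d o (GromovCl.bd d o ξ) (GromovCl.bd d o ξ) = ⊤ := by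
  refine top_le_iff.1 (le_sInf ?_)
  rintro _ ⟨u, hu, v, hv, rfl⟩
  have := tendsto_gromovProdFun_comp h hd hu hv tendsto_id tendsto_id
  exact (EReal.tendsto_coe_nhds_top_iff.2 this).liminf_eq.ge

/-- Sequences representing a boundary point converge to it in the Gromov closure. -/
theorem tendsto_pt_of_mem (h : FourPointCondition d o δ) (hd : IsPseudoDist d)
    (hδ : 0 ≤ δ) {ξ : GromovBdry d o} {u : ℕ → X}
    (hu : u ∈ gromovApproxSeqs d o (GromovCl.bd d o ξ)) :
    Tendsto (fun k => GromovCl.pt d o (u k)) atTop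
      (@nhds _ (gromovClTopology d o) (GromovCl.bd d o ξ)) := by
  refine TopologicalSpace.tendsto_nhds_generateFrom_iff.2 fun S hS hξ => ?_
  rcases hS with ⟨U, -, rfl⟩ | ⟨η, R, rfl⟩
  · obtain ⟨x, -, hx⟩ := hξ
    exact absurd hx Sum.inl_ne_inr
  by_contra hcon
  obtain ⟨R', hRR', hR'⟩ := EReal.lt_iff_exists_real_btwn.1
    (show (R : EReal) < extGromovProd d o (GromovCl.bd d o ξ) (GromovCl.bd d o η) from hξ)
  have hfreq : ∃ᶠ k in atTop, ¬ (R : EReal) < extGromovProd d o (GromovCl.pt d o (u k))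
    (GromovCl.bd d o η) := fun hev => hcon (hev.mono fun _ => not_not.1)
  obtain ⟨φ, hφ, hφlt⟩ := extraction_of_frequently_atTop hfreq
  obtain ⟨v, hv⟩ := exists_mem_gromovApproxSeqs (GromovCl.bd d o η)
  have hex : ∀ j, ∃ w k, j ≤ k ∧ gromovProdFun d o (u (φ j)) w < R' ∧
      (j : ℝ) ≤ gromovProdFun d o (v k) w := by
    intro j
    obtain ⟨_, ⟨c, hc, v', hv', rfl⟩, hlt⟩ := sInf_lt_iff.1 ((not_lt.1 (hφlt j)).trans_lt hRR')
    obtain rfl : c = fun _ => u (φ j) := hc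
    have hclose := (tendsto_gromovProdFun_comp h hd hv hv' tendsto_id
      tendsto_id).eventually_ge_atTop (j : ℝ)
    obtain ⟨k, hk, hk₁, hk₂⟩ := ((frequently_lt_of_liminf_lt (by isBoundedDefault)
      hlt).and_eventually (hclose.and (eventually_ge_atTop j))).exists
    exact ⟨v' k, k, hk₂, EReal.coe_lt_coe_iff.1 hk, hk₁⟩
  choose w k hjk hlt hge using hex
  have hvk := comp_mem_gromovApproxSeqs h hd hδ hv (tendsto_atTop_mono hjk tendsto_id)
  have hw := mem_gromovApproxSeqs_of_tendsto h hd hδ hvk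
    (tendsto_atTop_mono hge tendsto_natCast_atTop_atTop)
  have hle := extGromovProd_le (comp_mem_gromovApproxSeqs h hd hδ hu hφ.tendsto_atTop) hw
  refine (hR'.trans_le hle).not_ge (liminf_le_of_frequently_le' ?_)
  exact Frequently.of_forall fun j => EReal.coe_le_coe_iff.2 (hlt j).le

/-- In a proper geodesic space every sequence escaping to infinity has a subsequence which
is a Gromov sequence. -/
theorem exists_isGromovSeq_subseq (hd : IsPseudoDist d)
    (hcont : Continuous fun p : X × X => d p.1 p.2) (hprop : ∀ R, IsCompact {z | d o z ≤ R})
    (hgeod : ∀ x, ∃ γ, IsGeodesicFromTo d o x γ) {x : ℕ → X}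
    (hx : Tendsto (fun k => d o (x k)) atTop atTop) :
    ∃ φ : ℕ → ℕ, StrictMono φ ∧ IsGromovSeq d o fun k => x (φ k) := by
  choose γ hγ0 hγ1 hγ using fun k => hgeod (x k)
  have hA : ∀ N : ℕ, ∃ A ∈ hyperfilter ℕ, ∀ k ∈ A, ∀ m ∈ A,
      (N : ℝ) - 1 ≤ gromovProdFun d o (x k) (x m) := by
    intro N
    have hfar : ∀ᶠ k in (hyperfilter ℕ : Filter ℕ), (N : ℝ) ≤ d o (x k) :=
      Nat.hyperfilter_le_atTop (hx.eventually_ge_atTop (N : ℝ))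
    have hball : ∀ᶠ k in (hyperfilter ℕ : Filter ℕ), γ k N ∈ {z | d o z ≤ N} := by
      filter_upwards [hfar] with k hk
      have := hγ k 0 ⟨le_rfl, hd.nonneg _ _⟩ N ⟨N.cast_nonneg, hk⟩
      rw [hγ0, zero_sub, abs_neg, abs_of_nonneg N.cast_nonneg] at this
      exact this.le
    obtain ⟨z, -, hz⟩ := (hprop N).ultrafilter_le_nhds
      ((hyperfilter ℕ).map fun k => γ k N) (le_principal_iff.2 hball)
    have hdz : Tendsto (fun k => d z (γ k N)) (hyperfilter ℕ) (𝓝 0) := by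
      have : Tendsto (d z) (𝓝 z) (𝓝 (d z z)) :=
        (hcont.comp (Continuous.prodMk_right z)).tendsto z
      rw [hd.self] at this
      exact this.comp (hz : Tendsto _ _ _)
    refine ⟨_, hfar.and (hdz.eventually_lt_const one_pos), ?_⟩
    rintro k ⟨hk₁, hk₂⟩ m ⟨hm₁, hm₂⟩
    have tail : ∀ i, (N : ℝ) ≤ d o (x i) → d (γ i N) (x i) = d o (x i) - N := fun i hi => by
      have := hγ i N ⟨N.cast_nonneg, hi⟩ _ ⟨hd.nonneg _ _, le_rfl⟩
      rwa [hγ1, abs_sub_comm, abs_of_nonneg (sub_nonneg.2 hi)] at this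
    unfold gromovProdFun
    linarith [tail k hk₁, tail m hm₁, hd.triangle (x k) (γ k N) (x m),
      hd.triangle (γ k N) z (x m), hd.triangle z (γ m N) (x m), hd.comm (x k) (γ k N),
      hd.comm (γ k N) z, hd.comm (x k) o]
  choose A hAmem hA using hA
  obtain ⟨φ, hφ, hφA⟩ := extraction_forall_of_frequently
    (P := fun n k => ∀ i ∈ Finset.range (n + 1), k ∈ A i) fun n => by
      have : ∀ᶠ k in (hyperfilter ℕ : Filter ℕ), ∀ i ∈ Finset.range (n + 1), k ∈ A i :=
        (Filter.eventually_all_finset _).2 fun i _ => hAmem i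
      exact this.frequently.filter_mono Nat.hyperfilter_le_atTop
  refine ⟨φ, hφ, fun M => ?_⟩
  obtain ⟨N, hN⟩ := exists_nat_ge (M + 1)
  refine ⟨N, fun m hm n hn => ?_⟩
  linarith [hA N (φ m) (hφA m N (Finset.mem_range.2 (Nat.lt_succ_of_le hm))) (φ n)
    (hφA n N (Finset.mem_range.2 (Nat.lt_succ_of_le hn)))]

/-- A continuous map with relatively compact image, collapsing sequences whose Gromov products
tend to infinity, extends continuously to the Gromov closure. -/
theorem exists_continuous_extension (h : FourPointCondition d o δ) (hd : IsPseudoDist d)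
    {Y : Type*} [MetricSpace Y] {f : X → Y} (hf : Continuous f)
    (hcpt : IsCompact (closure (range f)))
    (hcollapse : ∀ (x y : ℕ → X) (p q : Y),
      Tendsto (fun k => gromovProdFun d o (x k) (y k)) atTop atTop →
      Tendsto (fun k => f (x k)) atTop (𝓝 p) → Tendsto (fun k => f (y k)) atTop (𝓝 q) → p = q) :
    ∃ Φ : GromovCl d o → Y, Continuous[gromovClTopology d o, _] Φ ∧
      ∀ a, ∀ u ∈ gromovApproxSeqs d o a, Tendsto (fun k => f (u k)) atTop (𝓝 (Φ a)) := by
  have hmem : ∀ x, f x ∈ closure (range f) := fun x => subset_closure (mem_range_self x)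
  have hlim : ∀ a : GromovCl d o, ∃ y, ∀ u ∈ gromovApproxSeqs d o a,
      Tendsto (fun k => f (u k)) atTop (𝓝 y) := by
    rintro (x | ξ)
    · refine ⟨f x, fun u hu => ?_⟩
      obtain rfl : u = fun _ => x := hu
      exact tendsto_const_nhds
    · obtain ⟨v, hv⟩ := exists_mem_gromovApproxSeqs (GromovCl.bd d o ξ)
      obtain ⟨y, -, φ, hφ, hy⟩ := hcpt.tendsto_subseq fun k => hmem (v k)
      refine ⟨y, fun u hu => tendsto_of_subseq_tendsto fun ns hns => ?_⟩
      obtain ⟨y', -, ψ, hψ, hy'⟩ := hcpt.tendsto_subseq fun k => hmem (u (ns k))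
      refine ⟨ψ, ?_⟩
      obtain rfl : y' = y := hcollapse _ _ y' y (tendsto_gromovProdFun_comp h hd hu hv
        (hns.comp hψ.tendsto_atTop) hφ.tendsto_atTop) hy' hy
      exact hy'
  choose Φ hΦ using hlim
  refine ⟨Φ, ?_, hΦ⟩
  let _ : TopologicalSpace (GromovCl d o) := gromovClTopology d o
  refine continuous_def.2 fun W hW => isOpen_iff_forall_mem_open.2 ?_
  rintro (x | ξ) ha
  · have hΦpt : ∀ z, Φ (GromovCl.pt d o z) = f z := fun z =>
      tendsto_nhds_unique (hΦ (GromovCl.pt d o z) (fun _ => z) rfl) tendsto_const_nhds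
    refine ⟨GromovCl.pt d o '' (f ⁻¹' W), ?_,
      TopologicalSpace.isOpen_generateFrom_of_mem (Or.inl ⟨_, hf.isOpen_preimage W hW, rfl⟩),
      mem_image_of_mem _ ?_⟩
    · rintro _ ⟨z, hz, rfl⟩
      rwa [mem_preimage, hΦpt]
    · rw [mem_preimage, ← hΦpt]
      exact ha
  suffices hR : ∃ R : ℕ, ∀ a,
      ((R : ℝ) : EReal) < extGromovProd d o a (GromovCl.bd d o ξ) → Φ a ∈ W by
    obtain ⟨R, hR⟩ := hR
    refine ⟨{a | ((R : ℝ) : EReal) < extGromovProd d o a (GromovCl.bd d o ξ)}, hR,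
      TopologicalSpace.isOpen_generateFrom_of_mem (Or.inr ⟨ξ, R, rfl⟩), ?_⟩
    change ((R : ℝ) : EReal) < extGromovProd d o (GromovCl.bd d o ξ) (GromovCl.bd d o ξ)
    rw [extGromovProd_bd_self h hd]
    exact EReal.coe_lt_top _
  by_contra! hcon
  choose a ha' haW using hcon
  obtain ⟨v, hv⟩ := exists_mem_gromovApproxSeqs (GromovCl.bd d o ξ)
  have hex : ∀ j : ℕ, ∃ x y, (j : ℝ) ≤ gromovProdFun d o x y ∧
      dist (f x) (Φ (a j)) < 1 / ((j : ℝ) + 1) ∧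
      dist (f y) (Φ (GromovCl.bd d o ξ)) < 1 / ((j : ℝ) + 1) := by
    intro j
    obtain ⟨u, hu⟩ := exists_mem_gromovApproxSeqs (a j)
    have h₁ := eventually_lt_of_lt_liminf ((ha' j).trans_le (extGromovProd_le hu hv))
    have hpos : 0 < 1 / ((j : ℝ) + 1) := Nat.one_div_pos_of_nat
    obtain ⟨k, hk₁, hk₂, hk₃⟩ := (h₁.and (((Metric.tendsto_nhds.1 (hΦ _ u hu)) _ hpos).and
      ((Metric.tendsto_nhds.1 (hΦ _ v hv)) _ hpos))).exists
    exact ⟨u k, v k, (EReal.coe_lt_coe_iff.1 hk₁).le, hk₂, hk₃⟩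
  choose x y hxy hxa hyξ using hex
  obtain ⟨p, -, φ, hφ, hp⟩ := hcpt.tendsto_subseq fun k => hmem (x k)
  have hy : Tendsto (fun k => f (y k)) atTop (𝓝 (Φ (GromovCl.bd d o ξ))) :=
    tendsto_iff_dist_tendsto_zero.2 (squeeze_zero (fun _ => dist_nonneg) (fun j => (hyξ j).le)
      tendsto_one_div_add_atTop_nhds_zero_nat)
  have hdist : Tendsto (fun k => dist (f (x k)) (Φ (a k))) atTop (𝓝 0) :=
    squeeze_zero (fun _ => dist_nonneg) (fun j => (hxa j).le)
      tendsto_one_div_add_atTop_nhds_zero_nat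
  have hap : Tendsto (fun k => Φ (a (φ k))) atTop (𝓝 p) :=
    (tendsto_iff_of_dist (hdist.comp hφ.tendsto_atTop)).1 hp
  have hpW : p ∉ W := hW.isClosed_compl.mem_of_tendsto hap (Eventually.of_forall fun k => haW (φ k))
  have hgp : Tendsto (fun k => gromovProdFun d o (x k) (y k)) atTop atTop :=
    tendsto_atTop_mono hxy tendsto_natCast_atTop_atTop
  exact hpW (hcollapse _ _ _ _ (hgp.comp hφ.tendsto_atTop) hp (hy.comp hφ.tendsto_atTop) ▸ ha)

end GromovCompactification

section Visibility

set_option linter.unusedSectionVars false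

variable [FiniteDimensional ℝ E] {Ω : Set E} {o : Ω} {δ : ℝ}

theorem tendsto_qhSubDist_atTop (hΩ : IsOpen Ω) (hconn : IsPreconnected Ω)
    (hbdd : Bornology.IsBounded Ω) (hc : Ωᶜ.Nonempty) {x : ℕ → Ω} {p : E} (hp : p ∉ Ω)
    (hx : Tendsto (fun k => (x k : E)) atTop (𝓝 p)) :
    Tendsto (fun k => qhSubDist Ω o (x k)) atTop atTop := by
  refine tendsto_atTop.2 fun M => ?_
  have hcl := ((isCompact_qhSubDist_le hΩ hconn hbdd hc o M).image
    continuous_subtype_val).isClosed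
  have hpn : p ∉ Subtype.val '' {z : Ω | qhSubDist Ω o z ≤ M} := by
    rintro ⟨z, -, rfl⟩
    exact hp z.2
  filter_upwards [hx.eventually (hcl.isOpen_compl.mem_nhds hpn)] with k hk
  exact (not_le.1 fun h => hk ⟨x k, h, rfl⟩).le

theorem mem_frontier_of_tendsto_qhSubDist (hΩ : IsOpen Ω) (hconn : IsPreconnected Ω)
    (hc : Ωᶜ.Nonempty) {x : ℕ → Ω} {p : E}
    (hd : Tendsto (fun k => qhSubDist Ω o (x k)) atTop atTop)
    (hx : Tendsto (fun k => (x k : E)) atTop (𝓝 p)) : p ∈ frontier Ω := by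
  have : CompleteSpace E := FiniteDimensional.complete ℝ E
  rw [hΩ.frontier_eq]
  refine ⟨mem_closure_of_tendsto hx (Eventually.of_forall fun k => (x k).2), fun hp => ?_⟩
  have hx' : Tendsto x atTop (𝓝 ⟨p, hp⟩) := tendsto_subtype_rng.2 hx
  have hcont : Continuous (qhSubDist Ω o) :=
    (continuous_qhSubDist hΩ hconn hc).comp (Continuous.prodMk_right o)
  exact not_tendsto_atTop_of_tendsto_nhds ((hcont.tendsto _).comp hx') hd

/-- Visibility forces sequences whose Gromov products tend to infinity to have the same
Euclidean limit. -/
theorem QHVisibilityDomain.eq_of_tendsto (hvis : QHVisibilityDomain Ω) (hΩ : IsOpen Ω)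
    (hconn : IsPreconnected Ω) (hbdd : Bornology.IsBounded Ω) (hc : Ωᶜ.Nonempty)
    {x y : ℕ → Ω} {p q : E}
    (hxy : Tendsto (fun k => gromovProdFun (qhSubDist Ω) o (x k) (y k)) atTop atTop)
    (hx : Tendsto (fun k => (x k : E)) atTop (𝓝 p))
    (hy : Tendsto (fun k => (y k : E)) atTop (𝓝 q)) : p = q := by
  have : CompleteSpace E := FiniteDimensional.complete ℝ E
  have hd := qhSubDist_isPseudoDist hΩ hconn hc
  have hcont : Continuous (qhSubDist Ω o) :=
    (continuous_qhSubDist hΩ hconn hc).comp (Continuous.prodMk_right o)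
  have hp : p ∈ frontier Ω := mem_frontier_of_tendsto_qhSubDist hΩ hconn hc
    (tendsto_atTop_mono (fun k => hd.gromovProdFun_le_left _ _) hxy) hx
  have hq : q ∈ frontier Ω := by
    refine mem_frontier_of_tendsto_qhSubDist (o := o) hΩ hconn hc (tendsto_atTop_mono (fun k => ?_) hxy) hy
    rw [hd.gromovProdFun_comm]
    exact hd.gromovProdFun_le_left _ _
  by_contra hpq
  obtain ⟨U, V, hU, hV, hpU, hqV, -, K, hK, hKΩ, hmeet⟩ := hvis p hp q hq hpq
  obtain ⟨C, hC⟩ := ((Subtype.isCompact_iff.2 (by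
    rwa [Subtype.image_preimage_coe, inter_eq_right.2 hKΩ]) :
      IsCompact ((↑) ⁻¹' K : Set Ω)).image hcont).bddAbove
  obtain ⟨k, ⟨hkU, hkV⟩, hkC⟩ := (((hx.eventually (hU.mem_nhds hpU)).and
    (hy.eventually (hV.mem_nhds hqV))).and (hxy.eventually_gt_atTop C)).exists
  obtain ⟨γ, hγ0, hγ1, hγ⟩ := exists_qhGeodesic hΩ hconn hbdd hc (x k) (y k)
  obtain ⟨t, ht, htK⟩ := hmeet (fun t => γ t) _ (hd.nonneg (x k) (y k))
    ⟨fun t _ => (γ t).2, hγ⟩ (hγ0.symm ▸ hkU) (hγ1.symm ▸ hkV)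
  have hCt : qhSubDist Ω o (γ t) ≤ C := hC (mem_image_of_mem _ htK)
  have h₁ := hγ 0 ⟨le_rfl, hd.nonneg _ _⟩ t ht
  have h₂ := hγ t ht _ ⟨hd.nonneg _ _, le_rfl⟩
  rw [hγ0, zero_sub, abs_neg, abs_of_nonneg ht.1] at h₁
  rw [hγ1, abs_sub_comm, abs_of_nonneg (sub_nonneg.2 ht.2)] at h₂
  unfold gromovProdFun at hkC
  linarith [hd.triangle o (γ t) (x k), hd.triangle o (γ t) (y k), hd.comm o (x k),
    hd.comm (x k) (γ t)]

theorem QHVisibilityDomain.exists_extension (hvis : QHVisibilityDomain Ω) (hΩ : IsOpen Ω)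
    (hconn : IsPreconnected Ω) (hbdd : Bornology.IsBounded Ω) (hc : Ωᶜ.Nonempty)
    (h : FourPointCondition (qhSubDist Ω) o δ) :
    ∃ Φ : QHGromovClosure Ω o → E, Continuous Φ ∧ (∀ x : Ω, Φ (qhClPt Ω o x) = x) ∧
      range Φ = closure Ω := by
  have : CompleteSpace E := FiniteDimensional.complete ℝ E
  have : ProperSpace E := FiniteDimensional.proper ℝ E
  have hd := qhSubDist_isPseudoDist hΩ hconn hc
  obtain ⟨Φ, hΦcont, hΦ⟩ := exists_continuous_extension h hd
    (f := ((↑) : Ω → E)) continuous_subtype_val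
    (by rw [Subtype.range_coe]; exact hbdd.isCompact_closure)
    (fun x y p q => hvis.eq_of_tendsto hΩ hconn hbdd hc)
  have hpt : ∀ x : Ω, Φ (GromovCl.pt _ o x) = x := fun x =>
    tendsto_nhds_unique (hΦ (GromovCl.pt _ o x) (fun _ => x) rfl) tendsto_const_nhds
  refine ⟨Φ, hΦcont, hpt, Subset.antisymm ?_ fun p hp => ?_⟩
  · rintro _ ⟨a, rfl⟩
    obtain ⟨u, hu⟩ := exists_mem_gromovApproxSeqs a
    exact mem_closure_of_tendsto (hΦ a u hu) (Eventually.of_forall fun k => (u k).2)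
  · by_cases hpΩ : p ∈ Ω
    · exact ⟨_, hpt ⟨p, hpΩ⟩⟩
    obtain ⟨x, hxΩ, hx⟩ := mem_closure_iff_seq_limit.1 hp
    obtain ⟨φ, hφ, hu⟩ := exists_isGromovSeq_subseq hd (continuous_qhSubDist hΩ hconn hc)
      (isCompact_qhSubDist_le hΩ hconn hbdd hc o) (exists_qhGeodesic hΩ hconn hbdd hc o)
      (tendsto_qhSubDist_atTop hΩ hconn hbdd hc (x := fun k => ⟨x k, hxΩ k⟩) hpΩ hx)
    exact ⟨GromovCl.bd _ o (Quot.mk _ ⟨_, hu⟩),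
      tendsto_nhds_unique (hΦ _ _ ⟨hu, rfl⟩) (hx.comp hφ.tendsto_atTop)⟩

/-- A quasihyperbolic geodesic of the domain, viewed as a geodesic of the subtype. -/
theorem IsQHGeodesicOn.exists_isGeodesicFromTo {γ : ℝ → E} {T : ℝ} (hT : 0 ≤ T)
    (hγ : IsQHGeodesicOn Ω γ (Icc 0 T)) : ∃ η : ℝ → Ω,
      IsGeodesicFromTo (qhSubDist Ω) (η 0) (η T) η ∧ qhSubDist Ω (η 0) (η T) = T ∧
      ∀ t ∈ Icc 0 T, (η t : E) = γ t := by
  set η : ℝ → Ω := IccExtend hT fun t => ⟨γ t, hγ.1 t t.2⟩ with hη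
  have hηγ : ∀ t ∈ Icc 0 T, (η t : E) = γ t := fun t ht => by
    rw [hη, IccExtend_of_mem hT _ ht]
  have hdist : ∀ s ∈ Icc 0 T, ∀ t ∈ Icc 0 T, qhSubDist Ω (η s) (η t) = |s - t| :=
    fun s hs t ht => by rw [qhSubDist, hηγ s hs, hηγ t ht, hγ.2 s hs t ht]
  have hL : qhSubDist Ω (η 0) (η T) = T := by
    rw [hdist 0 (left_mem_Icc.2 hT) T (right_mem_Icc.2 hT), zero_sub, abs_neg, abs_of_nonneg hT]
  exact ⟨η, ⟨rfl, by rw [hL], by rwa [hL]⟩, hL, hηγ⟩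

/-- If visibility fails at `p ≠ q`, then there are sequences converging to `p` and `q` whose
Gromov products tend to infinity. -/
theorem exists_tendsto_of_not_visible (hΩ : IsOpen Ω) (hconn : IsPreconnected Ω)
    (hbdd : Bornology.IsBounded Ω) (hc : Ωᶜ.Nonempty)
    (h : FourPointCondition (qhSubDist Ω) o δ) {p q : E} (hpq : p ≠ q)
    (hvis : ¬ ∃ U V : Set E, IsOpen U ∧ IsOpen V ∧ p ∈ U ∧ q ∈ V ∧
      closure U ∩ closure V = ∅ ∧
      ∃ K : Set E, IsCompact K ∧ K ⊆ Ω ∧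
        ∀ (γ : ℝ → E) (T : ℝ), 0 ≤ T → IsQHGeodesicOn Ω γ (Icc 0 T) →
          γ 0 ∈ U → γ T ∈ V → ∃ t ∈ Icc 0 T, γ t ∈ K) :
    ∃ x y : ℕ → Ω, Tendsto (fun k => (x k : E)) atTop (𝓝 p) ∧
      Tendsto (fun k => (y k : E)) atTop (𝓝 q) ∧
      Tendsto (fun k => gromovProdFun (qhSubDist Ω) o (x k) (y k)) atTop atTop := by
  have : CompleteSpace E := FiniteDimensional.complete ℝ E
  have hd := qhSubDist_isPseudoDist hΩ hconn hc
  have hpq' : 0 < dist p q := dist_pos.2 hpq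
  have hex : ∀ k : ℕ, ∃ x y : Ω, dist (x : E) p ≤ dist p q / 3 * (1 / ((k : ℝ) + 1)) ∧
      dist (y : E) q ≤ dist p q / 3 * (1 / ((k : ℝ) + 1)) ∧
      (k : ℝ) - 2 * δ ≤ gromovProdFun (qhSubDist Ω) o x y := by
    intro k
    set r := dist p q / 3 * (1 / ((k : ℝ) + 1)) with hr
    have hk : 0 < 1 / ((k : ℝ) + 1) := Nat.one_div_pos_of_nat
    have hr0 : 0 < r := by positivity
    have hk1 : 1 / ((k : ℝ) + 1) ≤ 1 := (div_le_one (by positivity)).2 (by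
      linarith [k.cast_nonneg (α := ℝ)])
    have hr1 : r ≤ dist p q / 3 := mul_le_of_le_one_right (by positivity) hk1
    have hdisj : closure (ball p r) ∩ closure (ball q r) = ∅ :=
      ((closedBall_disjoint_closedBall (by linarith)).mono closure_ball_subset_closedBall
        closure_ball_subset_closedBall).inter_eq
    by_contra! hcon
    refine hvis ⟨ball p r, ball q r, isOpen_ball, isOpen_ball, mem_ball_self hr0,
      mem_ball_self hr0, hdisj, Subtype.val '' {z : Ω | qhSubDist Ω o z ≤ k},
      (isCompact_qhSubDist_le hΩ hconn hbdd hc o k).image continuous_subtype_val,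
      Subtype.coe_image_subset _ _, fun γ T hT hγ h0 h1 => ?_⟩
    obtain ⟨η, hη, hL, hηγ⟩ := hγ.exists_isGeodesicFromTo hT
    obtain ⟨t, ht, hto⟩ := h.exists_dist_le hd hη
    rw [hL] at ht
    have h0' := hηγ 0 (left_mem_Icc.2 hT)
    have h1' := hηγ T (right_mem_Icc.2 hT)
    have hlt := hcon (η 0) (η T) (h0' ▸ (mem_ball.1 h0).le) (h1' ▸ (mem_ball.1 h1).le)
    exact ⟨t, ht, η t, show qhSubDist Ω o (η t) ≤ k by linarith, hηγ t ht⟩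
  choose x y hx hy hxy using hex
  have hlim : Tendsto (fun k : ℕ => dist p q / 3 * (1 / ((k : ℝ) + 1))) atTop (𝓝 0) := by
    simpa using tendsto_one_div_add_atTop_nhds_zero_nat.const_mul (dist p q / 3)
  exact ⟨x, y,
    tendsto_iff_dist_tendsto_zero.2 (squeeze_zero (fun _ => dist_nonneg) hx hlim),
    tendsto_iff_dist_tendsto_zero.2 (squeeze_zero (fun _ => dist_nonneg) hy hlim),
    tendsto_atTop_mono hxy (tendsto_atTop_add_const_right _ _ tendsto_natCast_atTop_atTop)⟩

theorem QHVisibilityDomain.of_extension (hΩ : IsOpen Ω) (hconn : IsPreconnected Ω)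
    (hbdd : Bornology.IsBounded Ω) (hc : Ωᶜ.Nonempty)
    (h : FourPointCondition (qhSubDist Ω) o δ) (hδ : 0 ≤ δ) {Φ : QHGromovClosure Ω o → E}
    (hΦ : Continuous Φ) (hpt : ∀ x : Ω, Φ (qhClPt Ω o x) = x) : QHVisibilityDomain Ω := by
  have : CompleteSpace E := FiniteDimensional.complete ℝ E
  have hd := qhSubDist_isPseudoDist hΩ hconn hc
  intro p hp q hq hpq
  by_contra hvis
  obtain ⟨x, y, hx, hy, hxy⟩ := exists_tendsto_of_not_visible hΩ hconn hbdd hc h hpq hvis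
  obtain ⟨φ, hφ, hu⟩ := exists_isGromovSeq_subseq hd (continuous_qhSubDist hΩ hconn hc)
    (isCompact_qhSubDist_le hΩ hconn hbdd hc o) (exists_qhGeodesic hΩ hconn hbdd hc o)
    (tendsto_atTop_mono (fun k => hd.gromovProdFun_le_left _ _) hxy)
  have hφ' := hφ.tendsto_atTop
  have hux : (fun k => x (φ k)) ∈
      gromovApproxSeqs _ o (GromovCl.bd _ o (Quot.mk _ ⟨_, hu⟩)) := ⟨hu, rfl⟩
  have huy := mem_gromovApproxSeqs_of_tendsto h hd hδ hux (hxy.comp hφ')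
  have hlim : ∀ {v : ℕ → Ω} {c : E},
      v ∈ gromovApproxSeqs _ o (GromovCl.bd _ o (Quot.mk _ ⟨_, hu⟩)) →
      Tendsto (fun k => (v k : E)) atTop (𝓝 c) →
      c = Φ (GromovCl.bd _ o (Quot.mk _ ⟨_, hu⟩)) := fun {v c} hv hc => by
    have := (hΦ.tendsto _).comp (tendsto_pt_of_mem h hd hδ hv)
    refine tendsto_nhds_unique hc (this.congr fun k => hpt (v k))
  exact hpq ((hlim hux (hx.comp hφ')).trans (hlim huy (hy.comp hφ')).symm)

end Visibility

/-- For a bounded domain `Ω ⊆ ℝⁿ` with `(Ω, k_Ω)` Gromov hyperbolic,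
`Ω` is a QH-visibility domain if and only if the identity map extends to a continuous
surjection from the Gromov closure of `(Ω, k_Ω)` onto the Euclidean closure of `Ω`. -/
theorem statement1 {n : ℕ} (Ω : Set (EuclideanSpace ℝ (Fin n)))
    (hOpen : IsOpen Ω) (hConn : IsConnected Ω) (hBdd : Bornology.IsBounded Ω)
    (hGromov : QHGromovHyperbolic Ω) (o : ↥Ω) :
    QHVisibilityDomain Ω ↔
      ∃ Φ : QHGromovClosure Ω o → EuclideanSpace ℝ (Fin n),
        Continuous Φ ∧ (∀ x : ↥Ω, Φ (qhClPt Ω o x) = (x : EuclideanSpace ℝ (Fin n))) ∧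
        Set.range Φ = closure Ω := by
  rcases Ωᶜ.eq_empty_or_nonempty with hc | hc
  · have huniv : Ω = univ := compl_empty_iff.1 hc
    have : Subsingleton (EuclideanSpace ℝ (Fin n)) := by
      by_contra hns
      have := not_subsingleton_iff_nontrivial.1 hns
      exact NormedSpace.unbounded_univ ℝ (EuclideanSpace ℝ (Fin n)) (huniv ▸ hBdd)
    refine ⟨fun _ => ⟨fun _ => o, continuous_const, fun x => Subsingleton.elim _ _, ?_⟩,
      fun _ p _ q _ hpq => absurd (Subsingleton.elim p q) hpq⟩
    rw [(Subset.antisymm (subset_univ _) (huniv ▸ subset_closure) : closure Ω = univ)]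
    exact eq_univ_of_forall fun x => ⟨qhClPt Ω o o, Subsingleton.elim _ _⟩
  · obtain ⟨δ, hδ, h⟩ := hGromov
    have h4 : FourPointCondition (qhSubDist Ω) o δ := fun x y z =>
      h o o.2 x x.2 y y.2 z z.2
    exact ⟨fun hvis => hvis.exists_extension hOpen hConn.isPreconnected hBdd hc h4,
      fun ⟨_, hΦ, hpt, _⟩ =>
        .of_extension hOpen hConn.isPreconnected hBdd hc h4 hδ hΦ hpt⟩

end
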